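/- Suppose q ≠ 1 and α, β ∈ k satisfy α + β = b and α·β = λ/(q−1). Then for every natural number n, ν(n) = Σ_{i=0}^{n} C(n,i)_q · β^i · α^{n−i}. -/

import Mathlib

/-- The q-integer `(n)_q = 1 + q + ⋯ + q^(n-1)`. -/
def qInt {k : Type*} [Field k] (q : k) (n : ℕ) : k := ∑ i ∈ Finset.range n, q ^ i

/-- The Gaussian (q-)binomial coefficient `C(n,i)_q`, defined via the q-Pascal
recursion; it vanishes when `i > n`. -/
def qBinom {k : Type*} [Field k] (q : k) : ℕ → ℕ → k
  | _, 0 => 1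
  | 0, _ + 1 => 0
  | n + 1, i + 1 => qBinom q n i + q ^ (i + 1) * qBinom q n (i + 1)

/-- The recursively defined sequence `ν(0) = 1`, `ν(1) = b`,
`ν(n) = b·ν(n-1) + λ·(n-1)_q·ν(n-2)`. -/
def nuSeq {k : Type*} [Field k] (q b lam : k) : ℕ → k
  | 0 => 1
  | 1 => b
  | n + 2 => b * nuSeq q b lam (n + 1) + lam * qInt q (n + 1) * nuSeq q b lam n

theorem qBinom_zero_right {k : Type*} [Field k] (q : k) (n : ℕ) : qBinom q n 0 = 1 := by
  cases n <;> rfl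

theorem qBinom_succ_succ {k : Type*} [Field k] (q : k) (n i : ℕ) :
    qBinom q (n + 1) (i + 1) = qBinom q n i + q ^ (i + 1) * qBinom q n (i + 1) :=
  rfl

theorem qBinom_eq_zero_of_lt {k : Type*} [Field k] (q : k) {n i : ℕ} (h : n < i) :
    qBinom q n i = 0 := by
  induction n generalizing i with
  | zero =>
    obtain _ | i := i
    · omega
    · rfl
  | succ n ih =>
    obtain _ | i := i
    · omega
    · rw [qBinom_succ_succ, ih (by omega), ih (by omega), mul_zero, add_zero]

/-- Absorption identity for Gaussian binomial coefficients. -/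
theorem pow_sub_one_mul_qBinom_succ_succ {k : Type*} [Field k] (q : k) (n i : ℕ) :
    (q ^ (i + 1) - 1) * qBinom q (n + 1) (i + 1) = (q ^ (n + 1) - 1) * qBinom q n i := by
  induction n generalizing i with
  | zero =>
    obtain _ | i := i
    · simp [qBinom]
    · simp [qBinom]
  | succ n ih =>
    have h := ih i
    rw [qBinom_succ_succ q (n + 1) i]
    obtain _ | i := i
    · rw [qBinom_zero_right] at h ⊢
      linear_combination q ^ (0 + 1) * h
    · linear_combination q ^ (i + 2) * h + q * ih i
        - q * (q ^ (n + 1) - 1) * qBinom_succ_succ q n i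

/-- The homogeneous Rogers–Szegő polynomial `∑ C(n,i)_q β^i α^(n-i)`. -/
def rogersSzego {k : Type*} [Field k] (q α β : k) (n : ℕ) : k :=
  ∑ i ∈ Finset.range (n + 1), qBinom q n i * β ^ i * α ^ (n - i)

theorem rogersSzego_succ {k : Type*} [Field k] (q α β : k) (n : ℕ) :
    rogersSzego q α β (n + 1) = β * rogersSzego q α β n +
      α * ∑ i ∈ Finset.range (n + 1), q ^ i * (qBinom q n i * β ^ i * α ^ (n - i)) := by
  have key : α * ∑ i ∈ Finset.range (n + 1), q ^ i * (qBinom q n i * β ^ i * α ^ (n - i)) =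
      ∑ i ∈ Finset.range (n + 2), q ^ i * (qBinom q n i * β ^ i * α ^ (n + 1 - i)) := by
    rw [Finset.sum_range_succ _ (n + 1), qBinom_eq_zero_of_lt q (Nat.lt_succ_self n),
      Finset.mul_sum]
    simp only [zero_mul, mul_zero, add_zero]
    refine Finset.sum_congr rfl fun i hi => ?_
    rw [Nat.succ_sub (Finset.mem_range_succ_iff.mp hi), pow_succ]
    ring
  rw [key, rogersSzego, rogersSzego, Finset.sum_range_succ', Finset.sum_range_succ' _ (n + 1),
    Finset.mul_sum, ← add_assoc, ← Finset.sum_add_distrib]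
  congr 1
  · refine Finset.sum_congr rfl fun i _ => ?_
    rw [qBinom_succ_succ, Nat.add_sub_add_right]
    ring
  · simp [qBinom_zero_right]

theorem sum_pow_mul_qBinom_sub_rogersSzego {k : Type*} [Field k] (q α β : k) (n : ℕ) :
    ∑ i ∈ Finset.range (n + 2), q ^ i * (qBinom q (n + 1) i * β ^ i * α ^ (n + 1 - i)) -
      rogersSzego q α β (n + 1) = (q ^ (n + 1) - 1) * β * rogersSzego q α β n := by
  rw [rogersSzego, rogersSzego, ← Finset.sum_sub_distrib, Finset.sum_range_succ',
    Finset.mul_sum]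
  simp only [pow_zero, one_mul, sub_self, add_zero]
  refine Finset.sum_congr rfl fun i _ => ?_
  rw [Nat.add_sub_add_right]
  linear_combination β ^ (i + 1) * α ^ (n - i) * pow_sub_one_mul_qBinom_succ_succ q n i

theorem rogersSzego_add_two {k : Type*} [Field k] (q α β : k) (n : ℕ) :
    rogersSzego q α β (n + 2) = (α + β) * rogersSzego q α β (n + 1) +
      α * β * (q ^ (n + 1) - 1) * rogersSzego q α β n := by
  linear_combination rogersSzego_succ q α β (n + 1) +
    α * sum_pow_mul_qBinom_sub_rogersSzego q α β n

theorem nuSeq_eq_rogersSzego {k : Type*} [Field k] (q α β : k) (n : ℕ) :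
    nuSeq q (α + β) (α * β * (q - 1)) n = rogersSzego q α β n := by
  induction n using Nat.twoStepInduction with
  | zero => simp [nuSeq, rogersSzego, qBinom]
  | one => simp [nuSeq, rogersSzego, qBinom, Finset.sum_range_succ]
  | more n ih₀ ih₁ =>
    have hgeom : qInt q (n + 1) * (q - 1) = q ^ (n + 1) - 1 := geom_sum_mul q (n + 1)
    rw [nuSeq, ih₀, ih₁, rogersSzego_add_two]
    linear_combination α * β * rogersSzego q α β n * hgeom

theorem nu_formula {k : Type*} [Field k] (q b lam : k) (hq : q ≠ 1)
    (α β : k) (hsum : α + β = b) (hprod : α * β = lam / (q - 1)) (n : ℕ) :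
    nuSeq q b lam n = ∑ i ∈ Finset.range (n + 1), qBinom q n i * β ^ i * α ^ (n - i) := by
  have hlam : lam = α * β * (q - 1) := by
    rw [hprod, div_mul_cancel₀ _ (sub_ne_zero.mpr hq)]
  rw [← hsum, hlam]
  exact nuSeq_eq_rogersSzego q α β n
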